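/- Let J be the standard matrix determined by dimension data (α_i^j). Then for all 1 ≤ i ≤ p and 1 ≤ j ≤ q the linear relation χ_ij(J) equals the (i,j)-relation of the standard bi-hinge determined by the same data; in particular, ker χ_ij(J) = V_i^{j+1} ⊕ ... ⊕ V_i^q, dom χ_ij(J) = V_i^j ⊕ ... ⊕ V_i^q, indef χ_ij(J) = W_j^1 ⊕ ... ⊕ W_j^{i−1}, and im χ_ij(J) = W_j^1 ⊕ ... ⊕ W_j^i. (Lemma 2.2.) -/

import Mathlib

namespace Neretin

open scoped BigOperators

variable {k : Type*} [Field k]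

/-- Offset of the `i`-th block of the partition `α`. -/
def off {p : ℕ} (α : Fin p → ℕ) (i : Fin p) : ℕ := ∑ i' ∈ Finset.Iio i, α i'

theorem coord_lt {p n : ℕ} {α : Fin p → ℕ} (hα : ∑ i, α i = n) (i : Fin p)
    (t : Fin (α i)) : off α i + (t : ℕ) < n := by
  have h1 : off α i + α i ≤ n := by
    rw [← hα]
    have h2 : insert i (Finset.Iio i) = Finset.Iic i := Finset.Iio_insert i
    have h3 : off α i + α i = ∑ i' ∈ Finset.Iic i, α i' := by
      rw [← h2, Finset.sum_insert (by simp)]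
      unfold off
      omega
    rw [h3]
    exact Finset.sum_le_sum_of_subset (Finset.subset_univ _)
  have h4 := t.isLt
  omega

/-- The coordinate of `k^n` corresponding to the `t`-th coordinate of the `i`-th block. -/
def coord {p n : ℕ} {α : Fin p → ℕ} (hα : ∑ i, α i = n) (i : Fin p) (t : Fin (α i)) : Fin n :=
  ⟨off α i + (t : ℕ), coord_lt hα i t⟩

/-- Subspace of vectors vanishing at all coordinates satisfying `P`. -/
def vanishOn {ι : Type*} (P : ι → Prop) : Submodule k (ι → k) :=
  ⨅ r ∈ {r : ι | P r}, LinearMap.ker (LinearMap.proj (R := k) (φ := fun _ : ι => k) r)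

/-- The linear relation `χ_ij(A) : V_i ⇉ W_j`. -/
def chi {p q n : ℕ} (α : Fin p → ℕ) (β : Fin q → ℕ) (hα : ∑ i, α i = n) (hβ : ∑ j, β j = n)
    (A : Matrix (Fin n) (Fin n) k) (i : Fin p) (j : Fin q) :
    Submodule k ((Fin (α i) → k) × (Fin (β j) → k)) :=
  Submodule.map
    ((LinearMap.funLeft k k (coord hα i)).prod
      ((LinearMap.funLeft k k (coord hβ j)).comp (Matrix.mulVecLin A)))
    (vanishOn (fun r : Fin n => off α i + α i ≤ (r : ℕ)) ⊓
      Submodule.comap (Matrix.mulVecLin A) (vanishOn fun r : Fin n => (r : ℕ) < off β j))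

section Rel

variable {X Y : Type*} [AddCommGroup X] [Module k X] [AddCommGroup Y] [Module k Y]

/-- Kernel of a linear relation. -/
def rker (L : Submodule k (X × Y)) : Submodule k X := Submodule.comap (LinearMap.inl k X Y) L

/-- Domain of a linear relation. -/
def rdom (L : Submodule k (X × Y)) : Submodule k X := Submodule.map (LinearMap.fst k X Y) L

/-- Image of a linear relation. -/
def rim (L : Submodule k (X × Y)) : Submodule k Y := Submodule.map (LinearMap.snd k X Y) L

/-- Indefiniteness of a linear relation. -/
def rindef (L : Submodule k (X × Y)) : Submodule k Y := Submodule.comap (LinearMap.inr k X Y) L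

end Rel

/-- `blockLT α a b`: coordinate `a` lies in a strictly earlier block than `b`. -/
def blockLT {p : ℕ} (α : Fin p → ℕ) (a b : ℕ) : Prop :=
  ∃ i : Fin p, off α i ≤ b ∧ a < off α i

/-- `sameBlock α a b` : coordinates `a`, `b` lie in the same block. -/
def sameBlock {p : ℕ} (α : Fin p → ℕ) (a b : ℕ) : Prop :=
  ∀ i : Fin p, off α i ≤ a ↔ off α i ≤ b

/-- Block upper triangular matrices (the group `P_+`). -/
def IsPPlus {n p : ℕ} (α : Fin p → ℕ) (g : Matrix (Fin n) (Fin n) k) : Prop :=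
  ∀ r s : Fin n, blockLT α (s : ℕ) (r : ℕ) → g r s = 0

/-- Block lower triangular matrices (the group `P_-`). -/
def IsPMinus {n p : ℕ} (α : Fin p → ℕ) (g : Matrix (Fin n) (Fin n) k) : Prop :=
  ∀ r s : Fin n, blockLT α (r : ℕ) (s : ℕ) → g r s = 0

/-- Block strictly upper triangular matrices (the group `T_+`). -/
def IsTPlus {n p : ℕ} (α : Fin p → ℕ) (g : Matrix (Fin n) (Fin n) k) : Prop :=
  IsPPlus α g ∧ ∀ r s : Fin n, sameBlock α (r : ℕ) (s : ℕ) → g r s = if r = s then 1 else 0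

/-- Block strictly lower triangular matrices (the group `T_-`). -/
def IsTMinus {n p : ℕ} (α : Fin p → ℕ) (g : Matrix (Fin n) (Fin n) k) : Prop :=
  IsPMinus α g ∧ ∀ r s : Fin n, sameBlock α (r : ℕ) (s : ℕ) → g r s = if r = s then 1 else 0

/-- Bi-hinges. -/
def IsBiHinge {p q : ℕ} (α : Fin p → ℕ) (β : Fin q → ℕ)
    (ξ : (i : Fin p) → (j : Fin q) → Submodule k ((Fin (α i) → k) × (Fin (β j) → k))) : Prop :=
  (∀ (i : Fin p) (j j' : Fin q), (j' : ℕ) = (j : ℕ) + 1 → rker (ξ i j) = rdom (ξ i j')) ∧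
  (∀ (i i' : Fin p) (j : Fin q), (i' : ℕ) = (i : ℕ) + 1 → rim (ξ i j) = rindef (ξ i' j)) ∧
  (∀ (i : Fin p) (j : Fin q), (i : ℕ) = 0 → rindef (ξ i j) = ⊥) ∧
  (∀ (i : Fin p) (j : Fin q), (i : ℕ) + 1 = p → rim (ξ i j) = ⊤) ∧
  (∀ (i : Fin p) (j : Fin q), (j : ℕ) + 1 = q → rker (ξ i j) = ⊥) ∧
  (∀ (i : Fin p) (j : Fin q), (j : ℕ) = 0 → rdom (ξ i j) = ⊤)

/-- 0-1 matrices with exactly one unit in each row and each column. -/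
def IsPermMatrix {n : ℕ} (M : Matrix (Fin n) (Fin n) k) : Prop :=
  ∃ σ : Equiv.Perm (Fin n), ∀ r s, M r s = if r = σ s then 1 else 0

/-- Offset of the sub-block `V_i^j` inside `V_i`. -/
def offA {p q : ℕ} (a : Fin p → Fin q → ℕ) (i : Fin p) (j : Fin q) : ℕ :=
  ∑ j' ∈ Finset.Iio j, a i j'

/-- Offset of the sub-block `W_j^i` inside `W_j`. -/
def offB {p q : ℕ} (a : Fin p → Fin q → ℕ) (i : Fin p) (j : Fin q) : ℕ :=
  ∑ i' ∈ Finset.Iio i, a i' j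

open Classical in
/-- The standard 0-1 matrix determined by the dimension data `a`. -/
noncomputable def stdMatrix {p q : ℕ} (n : ℕ) (α : Fin p → ℕ) (β : Fin q → ℕ)
    (a : Fin p → Fin q → ℕ) : Matrix (Fin n) (Fin n) k :=
  Matrix.of fun r s : Fin n =>
    if ∃ (i : Fin p) (j : Fin q) (t : ℕ), t < a i j ∧
        (s : ℕ) = off α i + offA a i j + t ∧ (r : ℕ) = off β j + offB a i j + t
      then (1 : k) else 0

/-- The standard bi-hinge determined by the dimension data `a`. -/
def stdHinge {p q : ℕ} (α : Fin p → ℕ) (β : Fin q → ℕ) (a : Fin p → Fin q → ℕ)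
    (i : Fin p) (j : Fin q) : Submodule k ((Fin (α i) → k) × (Fin (β j) → k)) where
  carrier := {z | (∀ u : Fin (α i), (u : ℕ) < offA a i j → z.1 u = 0) ∧
    (∀ v : Fin (β j), offB a i j + a i j ≤ (v : ℕ) → z.2 v = 0) ∧
    ∀ (u : Fin (α i)) (v : Fin (β j)) (t : ℕ), t < a i j →
      (u : ℕ) = offA a i j + t → (v : ℕ) = offB a i j + t → z.1 u = z.2 v}
  add_mem' := by
    rintro x y ⟨hx1, hx2, hx3⟩ ⟨hy1, hy2, hy3⟩
    refine ⟨fun u hu => ?_, fun v hv => ?_, fun u v t ht hu hv => ?_⟩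
    · show x.1 u + y.1 u = 0
      rw [hx1 u hu, hy1 u hu, add_zero]
    · show x.2 v + y.2 v = 0
      rw [hx2 v hv, hy2 v hv, add_zero]
    · show x.1 u + y.1 u = x.2 v + y.2 v
      rw [hx3 u v t ht hu hv, hy3 u v t ht hu hv]
  zero_mem' := ⟨fun _ _ => rfl, fun _ _ => rfl, fun _ _ _ _ _ _ => rfl⟩
  smul_mem' := by
    rintro c x ⟨hx1, hx2, hx3⟩
    refine ⟨fun u hu => ?_, fun v hv => ?_, fun u v t ht hu hv => ?_⟩
    · show c * x.1 u = 0
      rw [hx1 u hu, mul_zero]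
    · show c * x.2 v = 0
      rw [hx2 v hv, mul_zero]
    · show c * x.1 u = c * x.2 v
      rw [hx3 u v t ht hu hv]

theorem mem_vanishOn {ι : Type*} {P : ι → Prop} {x : ι → k} :
    x ∈ vanishOn (k := k) P ↔ ∀ r, P r → x r = 0 := by
  simp [vanishOn, Submodule.mem_iInf]

theorem off_add_le_off {p : ℕ} (f : Fin p → ℕ) {i j : Fin p} (h : i < j) :
    off f i + f i ≤ off f j := by
  have h1 : off f i + f i = ∑ l ∈ insert i (Finset.Iio i), f l := by
    rw [Finset.sum_insert (by simp), add_comm, off]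
  rw [h1, Finset.Iio_insert, off]
  refine Finset.sum_le_sum_of_subset fun l hl => ?_
  simp only [Finset.mem_Iic, Finset.mem_Iio] at hl ⊢
  exact hl.trans_lt h

theorem off_add_le_sum {p : ℕ} (f : Fin p → ℕ) (i : Fin p) :
    off f i + f i ≤ ∑ l, f l := by
  have h1 : off f i + f i = ∑ l ∈ insert i (Finset.Iio i), f l := by
    rw [Finset.sum_insert (by simp), add_comm, off]
  rw [h1]
  exact Finset.sum_le_sum_of_subset (Finset.subset_univ _)

theorem lt_of_off_lt {p : ℕ} {f : Fin p → ℕ} {i j : Fin p} {t : ℕ}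
    (h : off f i + t < off f j) : i < j := by
  by_contra hij
  rcases (not_lt.mp hij).eq_or_lt with rfl | hlt
  · omega
  · have := off_add_le_off f hlt
    omega

theorem lt_of_off_add_le {p : ℕ} {f : Fin p → ℕ} {i j : Fin p} {t : ℕ} (ht : t < f j)
    (h : off f i + f i ≤ off f j + t) : i < j := by
  by_contra hij
  rcases (not_lt.mp hij).eq_or_lt with rfl | hlt
  · omega
  · have := off_add_le_off f hlt
    omega

theorem off_add_inj {p : ℕ} {f : Fin p → ℕ} {i j : Fin p} {s t : ℕ} (hs : s < f i)
    (ht : t < f j) (h : off f i + s = off f j + t) : i = j ∧ s = t := by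
  have hij : i = j := by
    rcases lt_trichotomy i j with hlt | heq | hlt
    · have := off_add_le_off f hlt
      omega
    · exact heq
    · have := off_add_le_off f hlt
      omega
  subst hij
  exact ⟨rfl, by omega⟩

theorem exists_eq_off_add {p : ℕ} (f : Fin p → ℕ) {m : ℕ} (hm : m < ∑ i, f i) :
    ∃ (i : Fin p) (t : ℕ), t < f i ∧ m = off f i + t := by
  let e : (Σ i, Fin (f i)) → Fin (∑ i, f i) := fun x => coord rfl x.1 x.2
  have hinj : Function.Injective e := by
    rintro ⟨i, s⟩ ⟨j, t⟩ h
    obtain ⟨rfl, hst⟩ := off_add_inj s.isLt t.isLt (congrArg Fin.val h)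
    rw [Fin.ext hst]
  have hbij : Function.Bijective e :=
    (Fintype.bijective_iff_injective_and_card e).2 ⟨hinj, by simp⟩
  obtain ⟨⟨i, t⟩, h⟩ := hbij.2 ⟨m, hm⟩
  exact ⟨i, t, t.isLt, (congrArg Fin.val h).symm⟩

section StandardMatrix

variable {p q n : ℕ} {α : Fin p → ℕ} {β : Fin q → ℕ} {a : Fin p → Fin q → ℕ}

theorem offA_add_lt (hrow : ∀ i, ∑ j, a i j = α i) {i : Fin p} {j : Fin q} {t : ℕ}
    (ht : t < a i j) : offA a i j + t < α i := by
  have : offA a i j + a i j ≤ _ := off_add_le_sum (a i) j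
  rw [hrow] at this
  omega

theorem offB_add_lt (hcol : ∀ j, ∑ i, a i j = β j) {i : Fin p} {j : Fin q} {t : ℕ}
    (ht : t < a i j) : offB a i j + t < β j := by
  have : offB a i j + a i j ≤ _ := off_add_le_sum (fun i => a i j) i
  rw [hcol] at this
  omega

theorem exists_eq_offA_add (hrow : ∀ i, ∑ j, a i j = α i) {i : Fin p} {u : ℕ} (hu : u < α i) :
    ∃ (j : Fin q) (t : ℕ), t < a i j ∧ u = offA a i j + t :=
  exists_eq_off_add (a i) (by rwa [hrow])

theorem exists_eq_offB_add (hcol : ∀ j, ∑ i, a i j = β j) {j : Fin q} {v : ℕ} (hv : v < β j) :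
    ∃ (i : Fin p) (t : ℕ), t < a i j ∧ v = offB a i j + t :=
  exists_eq_off_add (fun i => a i j) (by rwa [hcol])

theorem sourceCoord_inj (hrow : ∀ i, ∑ j, a i j = α i) {i i' : Fin p} {j j' : Fin q} {t t' : ℕ}
    (ht : t < a i j) (ht' : t' < a i' j')
    (h : off α i + offA a i j + t = off α i' + offA a i' j' + t') :
    i = i' ∧ j = j' ∧ t = t' := by
  rw [add_assoc, add_assoc] at h
  obtain ⟨rfl, h2⟩ := off_add_inj (offA_add_lt hrow ht) (offA_add_lt hrow ht') h
  exact ⟨rfl, off_add_inj (f := a i) ht ht' h2⟩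

theorem targetCoord_inj (hcol : ∀ j, ∑ i, a i j = β j) {i i' : Fin p} {j j' : Fin q} {t t' : ℕ}
    (ht : t < a i j) (ht' : t' < a i' j')
    (h : off β j + offB a i j + t = off β j' + offB a i' j' + t') :
    i = i' ∧ j = j' ∧ t = t' := by
  rw [add_assoc, add_assoc] at h
  obtain ⟨rfl, h2⟩ := off_add_inj (offB_add_lt hcol ht) (offB_add_lt hcol ht') h
  obtain ⟨h3, h4⟩ := off_add_inj (f := fun i => a i j) ht ht' h2
  exact ⟨h3, rfl, h4⟩

theorem exists_sourceCoord (hα : ∑ i, α i = n) (hrow : ∀ i, ∑ j, a i j = α i) (s : Fin n) :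
    ∃ (i : Fin p) (j : Fin q) (t : ℕ), t < a i j ∧ (s : ℕ) = off α i + offA a i j + t := by
  obtain ⟨i, u, hu, hs⟩ := exists_eq_off_add α (m := s) (by rw [hα]; exact s.isLt)
  obtain ⟨j, t, ht, rfl⟩ := exists_eq_offA_add hrow hu
  exact ⟨i, j, t, ht, by omega⟩

theorem exists_targetCoord (hβ : ∑ j, β j = n) (hcol : ∀ j, ∑ i, a i j = β j) (r : Fin n) :
    ∃ (i : Fin p) (j : Fin q) (t : ℕ), t < a i j ∧ (r : ℕ) = off β j + offB a i j + t := by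
  obtain ⟨j, v, hv, hr⟩ := exists_eq_off_add β (m := r) (by rw [hβ]; exact r.isLt)
  obtain ⟨i, t, ht, rfl⟩ := exists_eq_offB_add hcol hv
  exact ⟨i, j, t, ht, by omega⟩

theorem sourceCoord_lt (hα : ∑ i, α i = n) (hrow : ∀ i, ∑ j, a i j = α i) {i : Fin p} {j : Fin q}
    {t : ℕ} (ht : t < a i j) : off α i + offA a i j + t < n := by
  have := coord_lt hα i ⟨_, offA_add_lt hrow ht⟩
  rwa [add_assoc]

theorem targetCoord_lt (hβ : ∑ j, β j = n) (hcol : ∀ j, ∑ i, a i j = β j) {i : Fin p} {j : Fin q}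
    {t : ℕ} (ht : t < a i j) : off β j + offB a i j + t < n := by
  have := coord_lt hβ j ⟨_, offB_add_lt hcol ht⟩
  rwa [add_assoc]

/-- The standard matrix sends the coordinates of `V_i^j` to those of `W_j^i`. -/
theorem stdMatrix_mulVec_apply (hcol : ∀ j, ∑ i, a i j = β j)
    (x : Fin n → k) {i : Fin p} {j : Fin q} {t : ℕ} (ht : t < a i j) {r s : Fin n}
    (hs : (s : ℕ) = off α i + offA a i j + t) (hr : (r : ℕ) = off β j + offB a i j + t) :
    (stdMatrix (k := k) n α β a).mulVec x r = x s := by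
  rw [Matrix.mulVec, dotProduct, Finset.sum_eq_single s]
  · rw [stdMatrix, Matrix.of_apply, if_pos ⟨i, j, t, ht, hs, hr⟩, one_mul]
  · intro s' _ hne
    rw [stdMatrix, Matrix.of_apply, if_neg, zero_mul]
    rintro ⟨i', j', t', ht', hs', hr'⟩
    obtain ⟨rfl, rfl, rfl⟩ := targetCoord_inj hcol ht ht' (hr.symm.trans hr')
    exact hne (Fin.ext (hs'.trans hs.symm))
  · simp

theorem exists_vec_apply_sourceCoord {M : Type*} (hα : ∑ i, α i = n)
    (hrow : ∀ i, ∑ j, a i j = α i) (g : Fin p → Fin q → ℕ → M) :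
    ∃ x : Fin n → M, ∀ (i : Fin p) (j : Fin q) (t : ℕ), t < a i j → ∀ s : Fin n,
      (s : ℕ) = off α i + offA a i j + t → x s = g i j t := by
  choose I J T hT hs using exists_sourceCoord (n := n) (a := a) hα hrow
  refine ⟨fun s => g (I s) (J s) (T s), fun i j t ht s h => ?_⟩
  obtain ⟨h1, h2, h3⟩ := sourceCoord_inj hrow (hT s) ht ((hs s).symm.trans h)
  simp only [h1, h2, h3]

theorem mem_chi (hα : ∑ i, α i = n) (hβ : ∑ j, β j = n) {A : Matrix (Fin n) (Fin n) k}
    {i : Fin p} {j : Fin q} {z : (Fin (α i) → k) × (Fin (β j) → k)} :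
    z ∈ chi α β hα hβ A i j ↔ ∃ x : Fin n → k,
      (∀ r : Fin n, off α i + α i ≤ (r : ℕ) → x r = 0) ∧
      (∀ r : Fin n, (r : ℕ) < off β j → A.mulVec x r = 0) ∧
      (∀ u, x (coord hα i u) = z.1 u) ∧ ∀ v, A.mulVec x (coord hβ j v) = z.2 v := by
  simp only [chi, Submodule.mem_map, Submodule.mem_inf, Submodule.mem_comap, mem_vanishOn,
    Matrix.mulVecLin_apply, Prod.ext_iff, funext_iff, and_assoc]
  rfl

theorem mem_stdHinge {i : Fin p} {j : Fin q} {z : (Fin (α i) → k) × (Fin (β j) → k)} :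
    z ∈ stdHinge α β a i j ↔
      (∀ u : Fin (α i), (u : ℕ) < offA a i j → z.1 u = 0) ∧
      (∀ v : Fin (β j), offB a i j + a i j ≤ (v : ℕ) → z.2 v = 0) ∧
      ∀ (u : Fin (α i)) (v : Fin (β j)) (t : ℕ), t < a i j →
        (u : ℕ) = offA a i j + t → (v : ℕ) = offB a i j + t → z.1 u = z.2 v :=
  Iff.rfl

theorem chi_stdMatrix_le_stdHinge (hα : ∑ i, α i = n) (hβ : ∑ j, β j = n)
    (hrow : ∀ i, ∑ j, a i j = α i) (hcol : ∀ j, ∑ i, a i j = β j) (i : Fin p) (j : Fin q) :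
    chi α β hα hβ (stdMatrix (k := k) n α β a) i j ≤ stdHinge α β a i j := by
  intro z hz
  obtain ⟨x, hx, hJx, hz1, hz2⟩ := (mem_chi hα hβ).1 hz
  refine mem_stdHinge.2 ⟨fun u hu => ?_, fun v hv => ?_, fun u v t ht hu hv => ?_⟩
  · obtain ⟨j', t, ht, hut⟩ := exists_eq_offA_add hrow u.isLt
    have hlt : j' < j := lt_of_off_lt (f := a i) (t := t) (hut ▸ hu)
    rw [← hz1, ← stdMatrix_mulVec_apply (α := α) hcol x ht (s := coord hα i u)
      (r := ⟨_, targetCoord_lt hβ hcol ht⟩) (by simp only [coord]; omega) rfl]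
    apply hJx
    have h1 := off_add_le_off β hlt
    have h2 := offB_add_lt hcol ht
    simp only
    omega
  · obtain ⟨i', t, ht, hvt⟩ := exists_eq_offB_add hcol v.isLt
    have hlt : i < i' := lt_of_off_add_le (f := fun i => a i j) (t := t) ht (hvt ▸ hv)
    rw [← hz2, stdMatrix_mulVec_apply (α := α) hcol x ht (s := ⟨_, sourceCoord_lt hα hrow ht⟩)
      (r := coord hβ j v) rfl (by simp only [coord]; omega)]
    apply hx
    have h1 := off_add_le_off α hlt
    simp only
    omega
  · rw [← hz1, ← hz2, stdMatrix_mulVec_apply (α := α) hcol x ht (s := coord hα i u)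
      (by simp only [coord]; omega) (by simp only [coord]; omega)]

theorem stdHinge_le_chi_stdMatrix (hα : ∑ i, α i = n) (hβ : ∑ j, β j = n)
    (hrow : ∀ i, ∑ j, a i j = α i) (hcol : ∀ j, ∑ i, a i j = β j) (i : Fin p) (j : Fin q) :
    stdHinge α β a i j ≤ chi α β hα hβ (stdMatrix (k := k) n α β a) i j := by
  intro z hz
  obtain ⟨h1, h2, h3⟩ := mem_stdHinge.1 hz
  obtain ⟨x, hx⟩ := exists_vec_apply_sourceCoord hα hrow fun i' j' t =>
    if i' = i then (if h : offA a i j' + t < α i then z.1 ⟨_, h⟩ else 0)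
    else if i' < i ∧ j' = j then (if h : offB a i' j + t < β j then z.2 ⟨_, h⟩ else 0)
    else 0
  refine (mem_chi hα hβ).2 ⟨x, fun s hs => ?_, fun r hr => ?_, fun u => ?_, fun v => ?_⟩
  · obtain ⟨i', j', t, ht, hst⟩ := exists_sourceCoord (a := a) hα hrow s
    have hlt : i < i' := lt_of_off_add_le (f := α) (offA_add_lt hrow ht) (by omega)
    rw [hx i' j' t ht s hst, if_neg hlt.ne', if_neg fun h => hlt.not_gt h.1]
  · obtain ⟨i', j', t, ht, hrt⟩ := exists_targetCoord (a := a) hβ hcol r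
    have hlt : j' < j := lt_of_off_lt (f := β) (t := offB a i' j' + t) (by omega)
    rw [stdMatrix_mulVec_apply (α := α) hcol x ht (s := ⟨_, sourceCoord_lt hα hrow ht⟩) rfl hrt,
      hx i' j' t ht _ rfl]
    split_ifs with hi h h' h
    · subst hi
      apply h1
      have h4 : offA a i' j' + a i' j' ≤ offA a i' j := off_add_le_off (a i') hlt
      simp only
      omega
    · rfl
    · exact absurd h'.2 hlt.ne
    · rfl
    · rfl
  · obtain ⟨j', t, ht, hut⟩ := exists_eq_offA_add hrow u.isLt
    rw [hx i j' t ht _ (by simp only [coord]; omega), if_pos rfl, dif_pos (hut ▸ u.isLt)]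
    exact congrArg z.1 (Fin.ext hut.symm)
  · obtain ⟨i', t, ht, hvt⟩ := exists_eq_offB_add hcol v.isLt
    rw [stdMatrix_mulVec_apply (α := α) hcol x ht (s := ⟨_, sourceCoord_lt hα hrow ht⟩) rfl
      (by simp only [coord]; omega), hx i' j t ht _ rfl]
    rcases lt_trichotomy i' i with hlt | rfl | hlt
    · rw [if_neg hlt.ne, if_pos ⟨hlt, rfl⟩, dif_pos (hvt ▸ v.isLt)]
      exact congrArg z.2 (Fin.ext hvt.symm)
    · rw [if_pos rfl, dif_pos (offA_add_lt hrow ht)]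
      exact h3 _ _ t ht rfl hvt
    · rw [if_neg hlt.ne', if_neg fun h => hlt.not_gt h.1]
      refine (h2 v ?_).symm
      have h4 : offB a i j + a i j ≤ offB a i' j := off_add_le_off (fun i => a i j) hlt
      omega

theorem rker_stdHinge (hcol : ∀ j, ∑ i, a i j = β j) (i : Fin p) (j : Fin q) :
    rker (stdHinge (k := k) α β a i j) =
      vanishOn (fun u : Fin (α i) => (u : ℕ) < offA a i j + a i j) := by
  ext ξ
  rw [rker, Submodule.mem_comap, mem_stdHinge, mem_vanishOn]
  constructor
  · rintro ⟨h1, -, h3⟩ u hu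
    by_cases h : (u : ℕ) < offA a i j
    · exact h1 u h
    · have ht : (u : ℕ) - offA a i j < a i j := by omega
      exact h3 u ⟨_, offB_add_lt hcol ht⟩ _ ht (by omega) rfl
  · intro h
    exact ⟨fun u hu => h u (by omega), fun _ _ => rfl, fun u _ t ht hu _ => h u (by omega)⟩

theorem rindef_stdHinge (hrow : ∀ i, ∑ j, a i j = α i) (i : Fin p) (j : Fin q) :
    rindef (stdHinge (k := k) α β a i j) =
      vanishOn (fun v : Fin (β j) => offB a i j ≤ (v : ℕ)) := by
  ext η
  rw [rindef, Submodule.mem_comap, mem_stdHinge, mem_vanishOn]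
  constructor
  · rintro ⟨-, h2, h3⟩ v hv
    by_cases h : offB a i j + a i j ≤ (v : ℕ)
    · exact h2 v h
    · have ht : (v : ℕ) - offB a i j < a i j := by omega
      exact (h3 ⟨_, offA_add_lt hrow ht⟩ v _ ht rfl (by omega)).symm
  · intro h
    exact ⟨fun _ _ => rfl, fun v hv => h v (by omega), fun _ v t ht _ hv => (h v (by omega)).symm⟩

theorem rdom_stdHinge (hrow : ∀ i, ∑ j, a i j = α i) (i : Fin p) (j : Fin q) :
    rdom (stdHinge (k := k) α β a i j) =
      vanishOn (fun u : Fin (α i) => (u : ℕ) < offA a i j) := by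
  ext ξ
  rw [rdom, Submodule.mem_map, mem_vanishOn]
  constructor
  · rintro ⟨z, hz, rfl⟩
    exact hz.1
  · intro h
    refine ⟨(ξ, fun v => if hv : (v : ℕ) - offB a i j < a i j then
      (if offB a i j + a i j ≤ (v : ℕ) then 0 else ξ ⟨_, offA_add_lt hrow hv⟩) else 0),
      mem_stdHinge.2 ⟨h, fun v hv => ?_, fun u v t ht hu hv => ?_⟩, rfl⟩
    · simp [hv]
    · have hvt : (v : ℕ) - offB a i j = t := by omega
      simp only
      rw [dif_pos (by omega), if_neg (by omega)]
      exact congrArg ξ (Fin.ext (by simp only; omega))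

theorem rim_stdHinge (hcol : ∀ j, ∑ i, a i j = β j) (i : Fin p) (j : Fin q) :
    rim (stdHinge (k := k) α β a i j) =
      vanishOn (fun v : Fin (β j) => offB a i j + a i j ≤ (v : ℕ)) := by
  ext η
  rw [rim, Submodule.mem_map, mem_vanishOn]
  constructor
  · rintro ⟨z, hz, rfl⟩
    exact hz.2.1
  · intro h
    refine ⟨(fun u => if hu : (u : ℕ) - offA a i j < a i j then
      (if (u : ℕ) < offA a i j then 0 else η ⟨_, offB_add_lt hcol hu⟩) else 0, η),
      mem_stdHinge.2 ⟨fun u hu => ?_, h, fun u v t ht hu hv => ?_⟩, rfl⟩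
    · simp [hu]
    · simp only
      rw [dif_pos (by omega), if_neg (by omega)]
      exact congrArg η (Fin.ext (by simp only; omega))

end StandardMatrix

theorem statement10 (p q n : ℕ) (hp : 0 < p) (hq : 0 < q)
    (α : Fin p → ℕ) (β : Fin q → ℕ)
    (hαpos : ∀ i, 0 < α i) (hβpos : ∀ j, 0 < β j)
    (hα : ∑ i, α i = n) (hβ : ∑ j, β j = n)
    (a : Fin p → Fin q → ℕ)
    (hrow : ∀ i, ∑ j, a i j = α i) (hcol : ∀ j, ∑ i, a i j = β j)
    (i : Fin p) (j : Fin q) :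
    chi α β hα hβ (stdMatrix (k := k) n α β a) i j = stdHinge α β a i j ∧
    rker (chi α β hα hβ (stdMatrix (k := k) n α β a) i j) =
      vanishOn (fun u : Fin (α i) => (u : ℕ) < offA a i j + a i j) ∧
    rdom (chi α β hα hβ (stdMatrix (k := k) n α β a) i j) =
      vanishOn (fun u : Fin (α i) => (u : ℕ) < offA a i j) ∧
    rindef (chi α β hα hβ (stdMatrix (k := k) n α β a) i j) =
      vanishOn (fun v : Fin (β j) => offB a i j ≤ (v : ℕ)) ∧
    rim (chi α β hα hβ (stdMatrix (k := k) n α β a) i j) =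
      vanishOn (fun v : Fin (β j) => offB a i j + a i j ≤ (v : ℕ)) := by
  have hchi : chi α β hα hβ (stdMatrix (k := k) n α β a) i j = stdHinge α β a i j :=
    le_antisymm (chi_stdMatrix_le_stdHinge hα hβ hrow hcol i j)
      (stdHinge_le_chi_stdMatrix hα hβ hrow hcol i j)
  rw [hchi]
  exact ⟨rfl, rker_stdHinge hcol i j, rdom_stdHinge hrow i j, rindef_stdHinge hrow i j,
    rim_stdHinge hcol i j⟩

end Neretin
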